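/- (Theorem 1) There is no real-analytic function f : ℝ → ℝ satisfying the similarity equation f'''(η) = 1 - (f'(η))² + f(η)·f''(η) for all η ≥ 0, the wall boundary conditions f(0) = 0 and f'(0) = 0, and the far-field condition f'(η) → 1 as η → ∞. -/

import Mathlib

open Filter Topology

/-- A differentiable function whose derivative tends to a positive limit tends to infinity. -/
theorem tendsto_atTop_of_tendsto_deriv_pos {f : ℝ → ℝ} {c : ℝ} (hf : Differentiable ℝ f)
    (hc : 0 < c) (h : Tendsto (deriv f) atTop (𝓝 c)) : Tendsto f atTop atTop := by
  obtain ⟨M, hM⟩ := eventually_atTop.1 (h.eventually_const_le (half_lt_self hc))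
  have hlin : Tendsto (fun x => f M + c / 2 * (x - M)) atTop atTop :=
    tendsto_atTop_add_const_left _ _
      ((tendsto_atTop_add_const_right _ (-M) tendsto_id).const_mul_atTop (half_pos hc))
  refine tendsto_atTop_mono' _ ?_ hlin
  filter_upwards [eventually_ge_atTop M] with x hx
  have := (convex_Ici M).mul_sub_le_image_sub_of_le_deriv hf.continuous.continuousOn
    hf.differentiableOn (C := c / 2)
    (fun y hy => hM y (interior_subset hy)) M Set.self_mem_Ici x hx hx
  linarith

/-- If a differentiable function has a finite limit at infinity, then its derivative tends to zero
along some sequence tending to infinity. -/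
theorem exists_seq_tendsto_deriv_zero {g : ℝ → ℝ} {c : ℝ} (hg : Differentiable ℝ g)
    (h : Tendsto g atTop (𝓝 c)) :
    ∃ ξ : ℕ → ℝ, Tendsto ξ atTop atTop ∧ Tendsto (fun n => deriv g (ξ n)) atTop (𝓝 0) := by
  have hmvt : ∀ n : ℕ, ∃ ξ ∈ Set.Ioo (n : ℝ) (n + 1), deriv g ξ = g (n + 1) - g n := by
    intro n
    obtain ⟨ξ, hξ, he⟩ := exists_deriv_eq_slope g (lt_add_one (n : ℝ))
      hg.continuous.continuousOn hg.differentiableOn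
    exact ⟨ξ, hξ, by simpa using he⟩
  choose ξ hξ he using hmvt
  refine ⟨ξ, tendsto_atTop_mono (fun n => (hξ n).1.le) tendsto_natCast_atTop_atTop, ?_⟩
  have hn : Tendsto (fun n : ℕ => (n : ℝ)) atTop atTop := tendsto_natCast_atTop_atTop
  simpa [he] using (h.comp (tendsto_atTop_add_const_right _ 1 hn)).sub (h.comp hn)

/-- A solution of `g'' = 1 - g² + f g'` with `f ≥ 0` near infinity that tends to `1` is eventually
equal to `1`: the energy `g'² / 2 + (g - 1)² + (g - 1)³ / 3` is nonnegative, nondecreasing, and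
tends to zero along a sequence. -/
theorem eventually_eq_one_of_tendsto_one {f g : ℝ → ℝ} (hg : Differentiable ℝ g)
    (hg' : Differentiable ℝ (deriv g)) (hf : ∀ᶠ x in atTop, 0 ≤ f x)
    (hode : ∀ᶠ x in atTop, deriv (deriv g) x = 1 - g x ^ 2 + f x * deriv g x)
    (hlim : Tendsto g atTop (𝓝 1)) : ∀ᶠ x in atTop, g x = 1 := by
  let E : ℝ → ℝ := fun x => deriv g x ^ 2 / 2 + (g x - 1) ^ 2 + (g x - 1) ^ 3 / 3
  have hE : ∀ x, HasDerivAt E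
      (deriv g x * (deriv (deriv g) x + g x ^ 2 - 1)) x := by
    intro x
    have h1 := (hg x).hasDerivAt.sub_const 1
    refine (((((hg' x).hasDerivAt.pow 2).div_const 2).add (h1.pow 2)).add
      ((h1.pow 3).div_const 3)).congr_deriv ?_
    push_cast
    ring
  obtain ⟨M, hM⟩ := eventually_atTop.1 (hf.and hode)
  have hmono : MonotoneOn E (Set.Ici M) := by
    refine monotoneOn_of_deriv_nonneg (convex_Ici M)
      (fun x _ => (hE x).continuousAt.continuousWithinAt)
      (fun x _ => (hE x).differentiableAt.differentiableWithinAt) fun x hx => ?_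
    obtain ⟨hx0, hx1⟩ := hM x (interior_subset hx)
    rw [(hE x).deriv, hx1]
    nlinarith [mul_nonneg hx0 (sq_nonneg (deriv g x))]
  obtain ⟨ξ, hξ, hξ'⟩ := exists_seq_tendsto_deriv_zero hg hlim
  have hElim : Tendsto (fun n => E (ξ n)) atTop (𝓝 0) := by
    have h1 := (hlim.comp hξ).sub_const 1
    simpa [E] using (((hξ'.pow 2).div_const 2).add (h1.pow 2)).add ((h1.pow 3).div_const 3)
  filter_upwards [eventually_ge_atTop M, hlim.eventually_const_le (u := 0) one_pos] with x hx hgx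
  have hEx : E x ≤ 0 := by
    refine ge_of_tendsto hElim ?_
    filter_upwards [hξ.eventually_ge_atTop x] with n hn
    exact hmono hx (hx.trans hn) hn
  have hsq : (g x - 1) ^ 2 = 0 := by
    refine le_antisymm ?_ (sq_nonneg _)
    have : E x = deriv g x ^ 2 / 2 + (g x - 1) ^ 2 * (2 / 3) + (g x - 1) ^ 2 * g x / 3 := by
      simp only [E]
      ring
    nlinarith [mul_nonneg (sq_nonneg (g x - 1)) hgx, sq_nonneg (deriv g x)]
  exact sub_eq_zero.1 (pow_eq_zero_iff two_ne_zero |>.1 hsq)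


/-- Theorem 1: there is no real-analytic solution of the rear stagnation-point
similarity equation `f''' = 1 - (f')² + f·f''` on `η ≥ 0` with the wall conditions
`f(0) = 0`, `f'(0) = 0` and the far-field condition `f'(η) → 1` as `η → ∞`. -/
theorem stmt_5 :
    ¬ ∃ f : ℝ → ℝ,
      (∀ x : ℝ, AnalyticAt ℝ f x) ∧
      (∀ η : ℝ, 0 ≤ η →
        iteratedDeriv 3 f η = 1 - (deriv f η) ^ 2 + f η * iteratedDeriv 2 f η) ∧
      f 0 = 0 ∧ deriv f 0 = 0 ∧
      Filter.Tendsto (deriv f) Filter.atTop (nhds 1) := by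
  rintro ⟨f, hf, hode, -, hf0, hlim⟩
  have hfa : AnalyticOnNhd ℝ f Set.univ := fun x _ => hf x
  have hdiff {u : ℝ → ℝ} (hu : AnalyticOnNhd ℝ u Set.univ) : Differentiable ℝ u :=
    fun x => (hu x trivial).differentiableAt
  have hev : ∀ᶠ x in atTop, deriv f x = 1 := by
    refine eventually_eq_one_of_tendsto_one (f := f) (hdiff hfa.deriv) (hdiff hfa.deriv.deriv)
      ((tendsto_atTop_of_tendsto_deriv_pos (hdiff hfa) one_pos hlim).eventually_ge_atTop 0)
      ?_ hlim
    filter_upwards [eventually_ge_atTop 0] with x hx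
    simpa [iteratedDeriv_succ, iteratedDeriv_zero] using hode x hx
  obtain ⟨M, hM⟩ := eventually_atTop.1 hev
  have heq : deriv f = fun _ => 1 :=
    hfa.deriv.eq_of_eventuallyEq (z₀ := M + 1) analyticOnNhd_const
      ((eventually_gt_nhds (lt_add_one M)).mono fun x hx => hM x hx.le)
  simp [heq] at hf0
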